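/- Let m ≥ 1, n ≥ 1 and let d ∈ ℤ with gcd(n, d) = 1. Then the cardinality of H_{n,d} equals the number of C_n-orbits C on U_n^{prim} with wt(C) ≡ −d (mod n). -/

import Mathlib

/-- `U_n`: sequences of `n` nonnegative integers summing to `(m−1)n`. -/
def USet (m n : ℕ) : Set (List ℕ) := {a | a.length = n ∧ a.sum = (m - 1) * n}

/-- The weight `wt(a) = ∑_{i=1}^n (n−i)(m−1−a_i)` of a sequence of length `n`. -/
def wtZ (m : ℕ) (a : List ℕ) : ℤ :=
  ∑ i ∈ Finset.range a.length, ((a.length : ℤ) - 1 - i) * ((m : ℤ) - 1 - a.getD i 0)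

/-- A sequence is primitive if it differs from all of its proper cyclic shifts. -/
def Primitive (a : List ℕ) : Prop := ∀ i, 0 < i → i < a.length → a.rotate i ≠ a

/-- `U_n^{prim}`: the primitive sequences in `U_n`. -/
def UPrim (m n : ℕ) : Set (List ℕ) := {a ∈ USet m n | Primitive a}

/-- The `C_n`-orbit (cyclic class) of a sequence. -/
def rotClass (a : List ℕ) : Set (List ℕ) := {b | ∃ i, b = a.rotate i}

/-- The set of `C_n`-orbits on a shift-invariant set `S`. -/
def orbitsOn (S : Set (List ℕ)) : Set (Set (List ℕ)) := {O | ∃ a ∈ S, O = rotClass a}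

/-- The weight of a cyclic class: the maximal weight of its elements. -/
noncomputable def wtOrb (m : ℕ) (O : Set (List ℕ)) : ℤ := sSup (wtZ m '' O)

/-- `H_{n,d}`: sequences `(l₁,…,l_n) ∈ ℤⁿ` with `l_{k+1} − l_k + (m−1) ≥ 0` for
`k = 1,…,n−1`, total sum `d`, and `(l₁+…+l_k)/k ≥ d/n` for all `k < n`. -/
def HSet (m n : ℕ) (d : ℤ) : Set (List ℤ) :=
  {l | l.length = n
    ∧ (∀ k, k + 1 < n → 0 ≤ l.getD (k + 1) 0 - l.getD k 0 + ((m : ℤ) - 1))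
    ∧ l.sum = d
    ∧ ∀ k, 0 < k → k < n → ((d : ℚ) / (n : ℚ)) ≤ (((l.take k).sum : ℤ) : ℚ) / (k : ℚ)}

/-- Periodic extension of a list. -/
def per {α : Type*} [Zero α] (l : List α) (i : ℕ) : α := l.getD (i % l.length) 0

theorem per_of_lt {α : Type*} [Zero α] (l : List α) (i : ℕ) (h : i < l.length) :
    per l i = l[i] := by
  unfold per
  rw [Nat.mod_eq_of_lt h, List.getD_eq_getElem _ _ h]

theorem getD_eq_per {α : Type*} [Zero α] (l : List α) (i : ℕ) (h : i < l.length) :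
    l.getD i 0 = per l i := by
  unfold per
  rw [Nat.mod_eq_of_lt h]

theorem per_add {α : Type*} [Zero α] (l : List α) (i : ℕ) :
    per l (i + l.length) = per l i := by
  unfold per
  rw [Nat.add_mod_right]

theorem per_ext {α : Type*} [Zero α] (l l' : List α) (h : l.length = l'.length)
    (hp : ∀ i < l.length, per l i = per l' i) : l = l' := by
  apply List.ext_getElem h
  intro i h1 h2
  have := hp i h1
  rwa [per_of_lt _ _ h1, per_of_lt _ _ h2] at this

theorem per_rotate {α : Type*} [Zero α] (l : List α) (k i : ℕ) :
    per (l.rotate k) i = per l (i + k) := by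
  rcases Nat.eq_zero_or_pos l.length with h0 | h0
  · have : l = [] := List.length_eq_zero_iff.mp h0
    subst this
    simp [per]
  · unfold per
    have h1 : i % (l.rotate k).length < (l.rotate k).length := by
      rw [List.length_rotate]; exact Nat.mod_lt _ h0
    rw [List.getD_eq_getElem _ _ h1, List.getD_eq_getElem _ _ (Nat.mod_lt _ h0)]
    rw [List.getElem_rotate]
    congr 1
    simp

theorem sum_take_per {α : Type*} [AddCommMonoid α] (l : List α) (k : ℕ) (hk : k ≤ l.length) :
    (l.take k).sum = ∑ i ∈ Finset.range k, per l i := by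
  induction k with
  | zero => simp
  | succ k ih =>
    rw [Finset.sum_range_succ, ← ih (by omega), per_of_lt l k (by omega),
      List.sum_take_succ _ _ (by omega)]

theorem sum_per {α : Type*} [AddCommMonoid α] (l : List α) :
    l.sum = ∑ i ∈ Finset.range l.length, per l i := by
  rw [← sum_take_per l _ le_rfl, List.take_length]

/-- The difference sequence. -/
def dA (m : ℕ) (l : List ℤ) : List ℕ :=
  (List.range l.length).map (fun i => (per l (i+1) - per l i + ((m:ℤ) - 1)).toNat)

theorem length_dA (m : ℕ) (l : List ℤ) : (dA m l).length = l.length := by simp [dA]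

theorem per_dA (m : ℕ) (l : List ℤ) (hl : 0 < l.length) (i : ℕ) :
    per (dA m l) i = (per l (i+1) - per l i + ((m:ℤ) - 1)).toNat := by
  have h2 : i % l.length < l.length := Nat.mod_lt _ hl
  have : per (dA m l) i = (per l (i % l.length+1) - per l (i % l.length) + ((m:ℤ) - 1)).toNat := by
    unfold per
    rw [length_dA, List.getD_eq_getElem _ _ (by rw [length_dA]; exact h2)]
    simp [dA, per]
  rw [this]
  have e1 : per l (i % l.length + 1) = per l (i+1) := by simp [per]
  have e2 : per l (i % l.length) = per l i := by simp [per]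
  rw [e1, e2]

theorem dA_rotate (m : ℕ) (l : List ℤ) (hl : 0 < l.length) (k : ℕ) :
    dA m (l.rotate k) = (dA m l).rotate k := by
  apply per_ext
  · simp [length_dA]
  · intro i _
    rw [per_dA _ _ (by simpa using hl), per_rotate, per_rotate, per_rotate, per_dA _ _ hl,
      Nat.add_right_comm]

/-- Cyclically admissible sequences of sum `d`. -/
def Gd (m n : ℕ) (d : ℤ) (l : List ℤ) : Prop :=
  l.length = n ∧ l.sum = d ∧ ∀ i, 0 ≤ per l (i+1) - per l i + ((m:ℤ) - 1)

theorem Gd.rotate {m n : ℕ} {d : ℤ} {l : List ℤ} (h : Gd m n d l) (k : ℕ) :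
    Gd m n d (l.rotate k) := by
  obtain ⟨h1, h2, h3⟩ := h
  refine ⟨by simpa using h1, ?_, ?_⟩
  · rw [← h2]; exact (List.rotate_perm l k).sum_eq
  · intro i
    rw [per_rotate, per_rotate, Nat.add_right_comm]
    exact h3 _

theorem Gd.per {m n : ℕ} (hn : 1 ≤ n) {d : ℤ} {l : List ℤ} (h : Gd m n d l) (i : ℕ) :
    ((_root_.per (dA m l) i : ℕ) : ℤ) = _root_.per l (i+1) - _root_.per l i + ((m:ℤ) - 1) := by
  rw [per_dA _ _ (by have := h.1; omega)]
  exact Int.toNat_of_nonneg (h.2.2 i)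

theorem Gd.mem {m n : ℕ} (hm : 1 ≤ m) (hn : 1 ≤ n) {d : ℤ} {l : List ℤ} (h : Gd m n d l) :
    dA m l ∈ USet m n := by
  refine ⟨by rw [length_dA]; exact h.1, ?_⟩
  rw [sum_per, length_dA, h.1]
  zify [hm]
  simp_rw [h.per hn]
  rw [Finset.sum_add_distrib, Finset.sum_range_sub]
  have : _root_.per l n = _root_.per l 0 := by
    have := per_add l 0
    rwa [h.1, zero_add] at this
  rw [this]
  simp
  ring

theorem abel_sum (f : ℕ → ℤ) (n : ℕ) :
    ∑ i ∈ Finset.range n, ((n:ℤ) - 1 - i) * (f i - f (i+1))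
      = n * f 0 - ∑ i ∈ Finset.range n, f i := by
  induction n with
  | zero => simp
  | succ n ih =>
    have : ∀ i ∈ Finset.range n, (((n+1:ℕ):ℤ) - 1 - i) * (f i - f (i+1))
        = ((n:ℤ) - 1 - i) * (f i - f (i+1)) + (f i - f (i+1)) := by
      intro i _; push_cast; ring
    rw [Finset.sum_range_succ, Finset.sum_congr rfl this, Finset.sum_add_distrib, ih,
      Finset.sum_range_sub', Finset.sum_range_succ]
    push_cast; ring

theorem wtZ_per (m : ℕ) (a : List ℕ) : wtZ m a =
    ∑ i ∈ Finset.range a.length, ((a.length : ℤ) - 1 - i) * ((m : ℤ) - 1 - per a i) := by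
  unfold wtZ
  apply Finset.sum_congr rfl
  intro i hi
  rw [getD_eq_per _ _ (Finset.mem_range.mp hi)]

theorem Gd.wt {m n : ℕ} (hn : 1 ≤ n) {d : ℤ} {l : List ℤ} (h : Gd m n d l) :
    wtZ m (dA m l) = n * _root_.per l 0 - d := by
  rw [wtZ_per, length_dA, h.1, ← h.2.1, sum_per, h.1, ← abel_sum]
  apply Finset.sum_congr rfl
  intro i _
  rw [h.per hn]; ring

theorem dA_inj {m n : ℕ} (hn : 1 ≤ n) {d : ℤ} {l l' : List ℤ} (h : Gd m n d l)
    (h' : Gd m n d l') (e : dA m l = dA m l') : l = l' := by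
  have h0 : per l 0 = per l' 0 := by
    have h1 := h.wt hn
    have h2 := h'.wt hn
    rw [e, h2] at h1
    have : (n:ℤ) * per l' 0 = n * per l 0 := by linarith
    exact (mul_left_cancel₀ (by positivity) this).symm
  apply per_ext _ _ (h.1.trans h'.1.symm)
  intro i _
  induction i with
  | zero => exact h0
  | succ i ih =>
    have := ih (by omega)
    have h1 := h.per hn i
    have h2 := h'.per hn i
    rw [e] at h1
    linarith

theorem dA_surj {m n : ℕ} (hm : 1 ≤ m) (hn : 1 ≤ n) {d : ℤ} {a : List ℕ} (h : a ∈ USet m n)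
    (hw : wtZ m a ≡ -d [ZMOD (n:ℤ)]) : ∃ l, Gd m n d l ∧ dA m l = a := by
  obtain ⟨hl, hs⟩ := h
  obtain ⟨x, hx⟩ := hw.symm.dvd
  let f : ℕ → ℤ := fun k => x + ∑ i ∈ Finset.range k, (((per a i : ℕ) : ℤ) - ((m:ℤ) - 1))
  let l : List ℤ := (List.range n).map f
  have hln : l.length = n := by simp [l]
  have hper : ∀ i < n, per l i = f i := by
    intro i hi
    rw [per_of_lt _ _ (by omega)]
    simp [l]
  have hfs : ∀ i, f (i+1) - f i = per a i - ((m:ℤ)-1) := by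
    intro i; simp only [f, Finset.sum_range_succ]; ring
  have hfn : f n = f 0 := by
    simp only [f]
    rw [Finset.sum_sub_distrib]
    have := sum_per a
    rw [hs, hl] at this
    zify [hm] at this
    rw [← this]
    simp
    ring
  have hper' : ∀ i < n, per l (i+1) = f (i+1) := by
    intro i hi
    rcases Nat.lt_or_ge (i+1) n with h | h
    · exact hper _ h
    · have e : i + 1 = n := by omega
      rw [e, hfn, ← hper 0 (by omega)]
      have := per_add l 0
      rwa [hln, zero_add] at this
  have hdiff : ∀ i, per l (i+1) - per l i = per a i - ((m:ℤ)-1) := by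
    intro i
    have hlt : i % n < n := Nat.mod_lt _ (by omega)
    have e1 : per l (i+1) = per l (i % n +1) := by simp [per, hln]
    have e2 : per l i = per l (i % n) := by simp [per, hln]
    have e3 : per a i = per a (i % n) := by simp [per, hl]
    rw [e1, e2, e3, hper' _ hlt, hper _ hlt, hfs]
  have hG : Gd m n d l := by
    refine ⟨hln, ?_, ?_⟩
    · rw [sum_per, hln, Finset.sum_congr rfl (fun i hi => hper i (Finset.mem_range.mp hi))]
      have h1 := abel_sum f n
      have h2 : wtZ m a = ∑ i ∈ Finset.range n, ((n:ℤ) - 1 - i) * (f i - f (i+1)) := by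
        rw [wtZ_per, hl]
        apply Finset.sum_congr rfl
        intro i _
        have := hfs i
        rw [show f i - f (i+1) = (m:ℤ) - 1 - per a i by linarith]
      have h3 : f 0 = x := by simp [f]
      rw [h3] at h1
      linarith
    · intro i
      rw [hdiff]
      have : (0:ℤ) ≤ ((per a i : ℕ) : ℤ) := by positivity
      linarith
  refine ⟨l, hG, ?_⟩
  apply per_ext
  · rw [length_dA, hln, hl]
  · intro i _
    have := hG.per hn i
    rw [hdiff] at this
    zify
    linarith

/-- Integral form of the slope condition. -/
def Slope (n : ℕ) (d : ℤ) (l : List ℤ) : Prop :=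
  ∀ k < n, d * k ≤ n * ∑ i ∈ Finset.range k, per l i

theorem mem_HSet_iff {m n : ℕ} (hm : 1 ≤ m) (hn : 1 ≤ n) {d : ℤ} {l : List ℤ} :
    l ∈ HSet m n d ↔ Gd m n d l ∧ Slope n d l := by
  have hslope : l.length = n →
      ((∀ k, 0 < k → k < n → ((d : ℚ) / (n : ℚ)) ≤ (((l.take k).sum : ℤ) : ℚ) / (k : ℚ))
        ↔ Slope n d l) := by
    intro hl
    have key : ∀ k, 0 < k → k < n →
        ((((d : ℚ) / (n : ℚ)) ≤ (((l.take k).sum : ℤ) : ℚ) / (k : ℚ))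
         ↔ d * k ≤ n * ∑ i ∈ Finset.range k, per l i) := by
      intro k hk hkn
      rw [sum_take_per l k (by omega), div_le_div_iff₀ (by positivity) (by positivity),
        mul_comm (n:ℤ)]
      norm_cast
    constructor
    · intro h k hk
      rcases Nat.eq_zero_or_pos k with h0 | h0
      · subst h0; simp
      · exact (key k h0 hk).1 (h k h0 hk)
    · intro h k h0 hk
      exact (key k h0 hk).2 (h k hk)
  constructor
  · rintro ⟨h1, h2, h3, h4⟩
    have hS := (hslope h1).1 h4
    refine ⟨⟨h1, h3, ?_⟩, hS⟩
    intro i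
    have hlt : i % n < n := Nat.mod_lt _ (by omega)
    have e1 : per l (i+1) = per l (i % n +1) := by simp [per, h1]
    have e2 : per l i = per l (i % n) := by simp [per, h1]
    rw [e1, e2]
    generalize i % n = j at hlt
    rcases Nat.lt_or_ge (j+1) n with h | h
    · rw [← getD_eq_per _ _ (by omega), ← getD_eq_per _ _ (by omega)]
      exact h2 j h
    · have e : j + 1 = n := by omega
      have e0 : per l (j+1) = per l 0 := by
        have := per_add l 0
        rwa [h1, zero_add, ← e] at this
      rw [e0]
      have hm' : (1:ℤ) ≤ m := by exact_mod_cast hm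
      rcases Nat.eq_zero_or_pos j with hj | hj
      · subst hj; linarith
      · have s1 := hS 1 (by omega)
        have s2 := hS j (by omega)
        have s3 := sum_per l
        rw [h3, h1, ← e, Finset.sum_range_succ] at s3
        simp only [Finset.sum_range_one, Nat.cast_one, mul_one] at s1
        have hjn : (n:ℤ) = j + 1 := by exact_mod_cast e.symm
        have hnpos : (0:ℤ) < n := by positivity
        have : (n:ℤ) * per l j ≤ n * per l 0 := by
          have : ∑ x ∈ Finset.range j, per l x = d - per l j := by linarith
          rw [this, hjn] at s2
          rw [hjn] at s1 ⊢
          nlinarith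
        have := le_of_mul_le_mul_left this hnpos
        linarith
  · rintro ⟨⟨h1, h3, h2⟩, hS⟩
    refine ⟨h1, ?_, h3, (hslope h1).2 hS⟩
    intro k hk
    rw [getD_eq_per _ _ (by omega), getD_eq_per _ _ (by omega)]
    exact h2 k

theorem sum_rot (l : List ℤ) (k j : ℕ) :
    ∑ i ∈ Finset.range j, per (l.rotate k) i
      = ∑ i ∈ Finset.range (k+j), per l i - ∑ i ∈ Finset.range k, per l i := by
  rw [Finset.sum_range_add]
  simp_rw [per_rotate, add_comm _ k]
  ring

theorem slope_unique {n : ℕ} {d : ℤ} (hd : Int.gcd (n : ℤ) d = 1) {l : List ℤ}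
    (hl : l.length = n) (hsum : l.sum = d) (k : ℕ) (hk : k < n) (h : Slope n d l)
    (h' : Slope n d (l.rotate k)) : k = 0 := by
  by_contra hk0
  have s1 := h k hk
  have s2 := h' (n-k) (by omega)
  rw [sum_rot, show k + (n-k) = n by omega] at s2
  have s3 := sum_per l
  rw [hsum, hl] at s3
  rw [← s3] at s2
  push_cast [hk.le] at s2
  have e : d * k = n * ∑ i ∈ Finset.range k, per l i := by nlinarith
  have hdvd : (n:ℤ) ∣ d * k := ⟨_, e⟩
  have : (n:ℤ) ∣ k := (Int.isCoprime_iff_gcd_eq_one.mpr hd).dvd_of_dvd_mul_left hdvd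
  have := Nat.le_of_dvd (by omega) (Int.natCast_dvd_natCast.mp this)
  omega

theorem slope_exists {n : ℕ} (hn : 1 ≤ n) {d : ℤ} {l : List ℤ}
    (hl : l.length = n) (hsum : l.sum = d) : ∃ k, Slope n d (l.rotate k) := by
  let P : ℕ → ℤ := fun k => n * ∑ i ∈ Finset.range k, per l i - d * k
  have hP : ∀ k, P (n + k) = P k := by
    intro k
    simp only [P]
    rw [Finset.sum_range_add]
    have s3 := sum_per l
    rw [hsum, hl] at s3
    rw [← s3]
    have : ∀ i, per l (n + i) = per l i := by
      intro i
      have := per_add l i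
      rwa [hl, add_comm] at this
    simp_rw [this]
    push_cast
    ring
  obtain ⟨k, hk, hmin⟩ := Finset.exists_min_image (Finset.range n) P ⟨0, by simp; omega⟩
  refine ⟨k, ?_⟩
  intro j hj
  have hk := Finset.mem_range.mp hk
  have : P k ≤ P (k + j) := by
    rcases Nat.lt_or_ge (k+j) n with h | h
    · exact hmin _ (Finset.mem_range.mpr h)
    · rw [show k + j = n + (k + j - n) by omega, hP]
      exact hmin _ (Finset.mem_range.mpr (by omega))
  rw [sum_rot]
  simp only [P] at this
  push_cast at this
  linarith

theorem rotClass_rotate (a : List ℕ) (k : ℕ) : rotClass (a.rotate k) = rotClass a := by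
  ext b
  constructor
  · rintro ⟨i, rfl⟩
    exact ⟨k + i, List.rotate_rotate _ _ _⟩
  · rintro ⟨i, rfl⟩
    have h : a ~r a.rotate k := ⟨k, rfl⟩
    have h2 : a ~r a.rotate i := ⟨i, rfl⟩
    obtain ⟨j, hj⟩ := h.symm.trans h2
    exact ⟨j, hj.symm⟩

theorem wtOrb_mem (m : ℕ) (a : List ℕ) : ∃ k, wtOrb m (rotClass a) = wtZ m (a.rotate k) := by
  have hfin : (rotClass a).Finite := by
    have : (rotClass a) ⊆ {b | b ∈ a.cyclicPermutations} := by
      rintro b ⟨i, rfl⟩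
      exact List.mem_cyclicPermutations_iff.mpr (List.IsRotated.symm ⟨i, rfl⟩)
    exact (List.finite_toSet _).subset this
  have hne : (rotClass a).Nonempty := ⟨a, 0, by simp⟩
  obtain ⟨b, ⟨k, rfl⟩, hb⟩ := (hne.image (wtZ m)).csSup_mem (hfin.image (wtZ m))
  exact ⟨k, hb.symm⟩

theorem USet_rotate {m n : ℕ} {a : List ℕ} (h : a ∈ USet m n) (k : ℕ) :
    a.rotate k ∈ USet m n := by
  refine ⟨by simpa using h.1, ?_⟩
  rw [← h.2]; exact (List.rotate_perm a k).sum_eq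

/-- For `gcd(n,d) = 1`, `|H_{n,d}|` equals the number of `C_n`-orbits `C` on
`U_n^{prim}` with `wt(C) ≡ −d (mod n)`. -/
theorem stmt18 (m n : ℕ) (hm : 1 ≤ m) (hn : 1 ≤ n) (d : ℤ)
    (hd : Int.gcd (n : ℤ) d = 1) :
    Set.ncard (HSet m n d)
      = Set.ncard {O ∈ orbitsOn (UPrim m n) | wtOrb m O ≡ -d [ZMOD (n : ℤ)]} := by
  symm
  have key : Set.BijOn (fun l => rotClass (dA m l)) (HSet m n d)
      {O ∈ orbitsOn (UPrim m n) | wtOrb m O ≡ -d [ZMOD (n : ℤ)]} := by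
    refine ⟨?_, ?_, ?_⟩
    · intro l hl
      obtain ⟨hG, hS⟩ := (mem_HSet_iff hm hn).1 hl
      have hlpos : 0 < l.length := by have := hG.1; omega
      refine ⟨⟨dA m l, ⟨hG.mem hm hn, ?_⟩, rfl⟩, ?_⟩
      · intro i hi0 hi heq
        rw [length_dA, hG.1] at hi
        rw [← dA_rotate _ _ hlpos] at heq
        have := dA_inj hn (hG.rotate i) hG heq
        have := slope_unique hd hG.1 hG.2.1 i hi hS (by rw [this]; exact hS)
        omega
      · obtain ⟨k, hk⟩ := wtOrb_mem m (dA m l)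
        show wtOrb m (rotClass (dA m l)) ≡ -d [ZMOD (n : ℤ)]
        rw [hk, ← dA_rotate _ _ hlpos, (hG.rotate k).wt hn]
        apply Int.ModEq.symm
        rw [Int.modEq_iff_dvd]
        exact ⟨per (l.rotate k) 0, by ring⟩
    · intro l hl l' hl' heq
      obtain ⟨hG, hS⟩ := (mem_HSet_iff hm hn).1 hl
      obtain ⟨hG', hS'⟩ := (mem_HSet_iff hm hn).1 hl'
      have hlpos : 0 < l.length := by have := hG.1; omega
      have hmem : dA m l' ∈ rotClass (dA m l) := by
        have heq' : rotClass (dA m l) = rotClass (dA m l') := heq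
        rw [heq']; exact ⟨0, by simp⟩
      obtain ⟨k, hk⟩ := hmem
      rw [← dA_rotate _ _ hlpos] at hk
      have e := dA_inj hn hG' (hG.rotate k) hk
      rw [← List.rotate_mod, hG.1] at e
      have := slope_unique hd hG.1 hG.2.1 (k % n) (Nat.mod_lt _ (by omega)) hS (e ▸ hS')
      rw [this] at e
      simpa using e.symm
    · rintro O ⟨⟨a, ⟨ha, _⟩, rfl⟩, hw⟩
      obtain ⟨k, hk⟩ := wtOrb_mem m a
      rw [hk] at hw
      obtain ⟨l, hG, hl⟩ := dA_surj hm hn (USet_rotate ha k) hw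
      have hlpos : 0 < l.length := by have := hG.1; omega
      obtain ⟨j, hj⟩ := slope_exists hn hG.1 hG.2.1
      refine ⟨l.rotate j, (mem_HSet_iff hm hn).2 ⟨hG.rotate j, hj⟩, ?_⟩
      show rotClass (dA m (l.rotate j)) = rotClass a
      rw [dA_rotate _ _ hlpos, rotClass_rotate, hl, rotClass_rotate]
  rw [← key.image_eq, key.injOn.ncard_image]
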